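/- arXiv:1204.4886 — 6 statements merged into one kernel-verified Lean document; each statement's English description precedes it below -/
import Mathlib

section
/- For every simplicial group G, the data W_gr G — with n-simplices (W_gr G)_n = G_n × G_{n-1} × ... × G_0 equipped with the componentwise group structure, face maps d_0(g_n,...,g_0) = (g_{n-1},...,g_0) and d_i(g_n,...,g_0) = (d_i g_n, d_{i-1} g_{n-1}, ..., d_1 g_{n-i+1}, g_{n-i-1}, ..., g_0) for i > 0, and degeneracy maps s_i(g_n,...,g_0) = (s_i g_n, s_{i-1} g_{n-1}, ..., s_0 g_{n-i}, g_{n-i}, g_{n-i-1}, ..., g_0) — satisfies the simplicial identities and all its face and degeneracy maps are group homomorphisms; hence W_gr G is a simplicial group. -/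
universe u

/-- The data of a simplicial group: a group `X n` for each `n`, with face maps
`d n i : X (n+1) → X n` (meaningful for `i ≤ n+1`) and degeneracy maps
`s n i : X n → X (n+1)` (meaningful for `i ≤ n`). -/
structure SGrpData where
  X : ℕ → Type u
  grp : ∀ n, Group (X n)
  d : ∀ n, ℕ → X (n+1) → X n
  s : ∀ n, ℕ → X n → X (n+1)

attribute [instance] SGrpData.grp

/-- A simplicial group: the data satisfies the simplicial identities and all face and
degeneracy maps are group homomorphisms. -/
structure SGrp extends SGrpData where
  d_mul : ∀ n i (x y : X (n+1)), d n i (x * y) = d n i x * d n i y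
  s_mul : ∀ n i (x y : X n), s n i (x * y) = s n i x * s n i y
  d_d : ∀ n i j, i < j → j ≤ n + 2 → ∀ x : X (n+2),
    d n i (d (n+1) j x) = d n (j-1) (d (n+1) i x)
  s_s : ∀ n i j, i ≤ j → j ≤ n → ∀ x : X n,
    s (n+1) i (s n j x) = s (n+1) (j+1) (s n i x)
  d_s_lt : ∀ n i j, i < j → j ≤ n + 1 → ∀ x : X (n+1),
    d (n+1) i (s (n+1) j x) = s n (j-1) (d n i x)
  d_s_self : ∀ n j, j ≤ n → ∀ x : X n, d n j (s n j x) = x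
  d_s_succ : ∀ n j, j ≤ n → ∀ x : X n, d n (j+1) (s n j x) = x
  d_s_gt : ∀ n i j, j + 1 < i → i ≤ n + 2 → ∀ x : X (n+1),
    d (n+1) i (s (n+1) j x) = s n j (d n (i-1) x)

/-- The underlying family of the W-construction: `WObj G n = G_n × G_{n-1} × ⋯ × G_0`. -/
def WObj (G : SGrpData.{u}) : ℕ → Type u
  | 0 => G.X 0
  | n+1 => G.X (n+1) × WObj G n

/-- Componentwise group structure on `WObj G n`. -/
instance WGroup (G : SGrpData.{u}) : ∀ n, Group (WObj G n)
  | 0 => G.grp 0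
  | n+1 => @Prod.instGroup _ _ (G.grp (n+1)) (WGroup G n)

/-- Face maps of `W_gr G`:
`d_0(g_n,…,g_0) = (g_{n-1},…,g_0)` and
`d_i(g_n,…,g_0) = (d_i g_n, …, d_1 g_{n-i+1}, g_{n-i-1}, …, g_0)` for `i > 0`. -/
def Wd (G : SGrpData.{u}) : ∀ n, ℕ → WObj G (n+1) → WObj G n
  | _, 0, x => x.2
  | 0, i+1, x => G.d 0 (i+1) x.1
  | n+1, i+1, x => (G.d (n+1) (i+1) x.1, Wd G n i x.2)

/-- Degeneracy maps of `W_gr G`: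
`s_i(g_n,…,g_0) = (s_i g_n, …, s_0 g_{n-i}, g_{n-i}, g_{n-i-1}, …, g_0)`. -/
def Ws (G : SGrpData.{u}) : ∀ n, ℕ → WObj G n → WObj G (n+1)
  | 0, _, x => (G.s 0 0 x, x)
  | n+1, 0, x => (G.s (n+1) 0 x.1, x)
  | n+1, i+1, x => (G.s (n+1) (i+1) x.1, Ws G n i x.2)

/-- The simplicial-group data of `W_gr G`. -/
def WgrData (G : SGrpData.{u}) : SGrpData.{u} where
  X := WObj G
  grp := WGroup G
  d := Wd G
  s := Ws G
/-- The property, for simplicial-group data, of satisfying all simplicial identities with all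
face and degeneracy maps group homomorphisms (i.e. being a simplicial group). -/
def IsSimplicialGroup (D : SGrpData.{u}) : Prop :=
  (∀ n i (x y : D.X (n+1)), D.d n i (x * y) = D.d n i x * D.d n i y) ∧
  (∀ n i (x y : D.X n), D.s n i (x * y) = D.s n i x * D.s n i y) ∧
  (∀ n i j, i < j → j ≤ n + 2 → ∀ x : D.X (n+2),
    D.d n i (D.d (n+1) j x) = D.d n (j-1) (D.d (n+1) i x)) ∧
  (∀ n i j, i ≤ j → j ≤ n → ∀ x : D.X n,
    D.s (n+1) i (D.s n j x) = D.s (n+1) (j+1) (D.s n i x)) ∧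
  (∀ n i j, i < j → j ≤ n + 1 → ∀ x : D.X (n+1),
    D.d (n+1) i (D.s (n+1) j x) = D.s n (j-1) (D.d n i x)) ∧
  (∀ n j, j ≤ n → ∀ x : D.X n, D.d n j (D.s n j x) = x) ∧
  (∀ n j, j ≤ n → ∀ x : D.X n, D.d n (j+1) (D.s n j x) = x) ∧
  (∀ n i j, j + 1 < i → i ≤ n + 2 → ∀ x : D.X (n+1),
    D.d (n+1) i (D.s (n+1) j x) = D.s n j (D.d n (i-1) x))

theorem Wd_mul (G : SGrp.{u}) : ∀ n i (x y : WObj G.toSGrpData (n+1)),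
    Wd G.toSGrpData n i (x * y) = Wd G.toSGrpData n i x * Wd G.toSGrpData n i y
  | 0, 0, _, _ => rfl
  | _+1, 0, _, _ => rfl
  | 0, i+1, x, y => G.d_mul 0 (i+1) x.1 y.1
  | n+1, i+1, x, y => Prod.ext (G.d_mul (n+1) (i+1) x.1 y.1) (Wd_mul G n i x.2 y.2)

theorem Ws_mul (G : SGrp.{u}) : ∀ n i (x y : WObj G.toSGrpData n),
    Ws G.toSGrpData n i (x * y) = Ws G.toSGrpData n i x * Ws G.toSGrpData n i y
  | 0, _, x, y => Prod.ext (G.s_mul 0 0 x y) rfl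
  | n+1, 0, x, y => Prod.ext (G.s_mul (n+1) 0 x.1 y.1) rfl
  | n+1, i+1, x, y => Prod.ext (G.s_mul (n+1) (i+1) x.1 y.1) (Ws_mul G n i x.2 y.2)

theorem Wd_Wd (G : SGrp.{u}) : ∀ n i j, i ≤ j → j ≤ n + 1 → ∀ x : WObj G.toSGrpData (n+2),
    Wd G.toSGrpData n i (Wd G.toSGrpData (n+1) (j+1) x) =
      Wd G.toSGrpData n j (Wd G.toSGrpData (n+1) i x)
  | 0, 0, _, _, _, _ => rfl
  | _+1, 0, _, _, _, _ => rfl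
  | 0, i+1, j+1, h, h', x => G.d_d 0 (i+1) (j+2) (by omega) (by omega) x.1
  | n+1, i+1, j+1, h, h', x =>
    Prod.ext (G.d_d (n+1) (i+1) (j+2) (by omega) (by omega) x.1)
      (Wd_Wd G n i j (by omega) (by omega) x.2)

theorem Ws_Ws (G : SGrp.{u}) : ∀ n i j, i ≤ j → j ≤ n → ∀ x : WObj G.toSGrpData n,
    Ws G.toSGrpData (n+1) i (Ws G.toSGrpData n j x) =
      Ws G.toSGrpData (n+1) (j+1) (Ws G.toSGrpData n i x)
  | 0, 0, 0, _, _, x => Prod.ext (G.s_s 0 0 0 le_rfl le_rfl x) rfl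
  | 0, i+1, 0, h, _, _ => by omega
  | 0, _, j+1, _, h', _ => by omega
  | n+1, 0, 0, _, _, x => Prod.ext (G.s_s (n+1) 0 0 le_rfl (by omega) x.1) rfl
  | n+1, 0, j+1, _, h', x => Prod.ext (G.s_s (n+1) 0 (j+1) (by omega) h' x.1) rfl
  | n+1, i+1, j+1, h, h', x =>
    Prod.ext (G.s_s (n+1) (i+1) (j+1) h h' x.1) (Ws_Ws G n i j (by omega) (by omega) x.2)

theorem Wd_Ws_of_le (G : SGrp.{u}) : ∀ n i j, i ≤ j → j ≤ n →
    ∀ x : WObj G.toSGrpData (n+1),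
    Wd G.toSGrpData (n+1) i (Ws G.toSGrpData (n+1) (j+1) x) =
      Ws G.toSGrpData n j (Wd G.toSGrpData n i x)
  | 0, 0, _, _, _, _ => rfl
  | _+1, 0, _, _, _, _ => rfl
  | 0, i+1, j+1, h, h', _ => by omega
  | n+1, i+1, j+1, h, h', x =>
    Prod.ext (G.d_s_lt (n+1) (i+1) (j+2) (by omega) (by omega) x.1)
      (Wd_Ws_of_le G n i j (by omega) (by omega) x.2)

theorem Wd_Ws_self (G : SGrp.{u}) : ∀ n j, j ≤ n → ∀ x : WObj G.toSGrpData n,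
    Wd G.toSGrpData n j (Ws G.toSGrpData n j x) = x
  | 0, 0, _, _ => rfl
  | _+1, 0, _, _ => rfl
  | n+1, j+1, h, x =>
    Prod.ext (G.d_s_self (n+1) (j+1) h x.1) (Wd_Ws_self G n j (by omega) x.2)

theorem Wd_succ_Ws (G : SGrp.{u}) : ∀ n j, j ≤ n → ∀ x : WObj G.toSGrpData n,
    Wd G.toSGrpData n (j+1) (Ws G.toSGrpData n j x) = x
  | 0, 0, _, x => G.d_s_succ 0 0 le_rfl x
  | 0+1, 0, _, x => Prod.ext (G.d_s_succ 1 0 (by omega) x.1) rfl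
  | n+2, 0, _, x => Prod.ext (G.d_s_succ (n+2) 0 (by omega) x.1) rfl
  | n+1, j+1, h, x =>
    Prod.ext (G.d_s_succ (n+1) (j+1) h x.1) (Wd_succ_Ws G n j (by omega) x.2)

theorem Wd_Ws_of_lt (G : SGrp.{u}) : ∀ n i j, j < i → i ≤ n + 1 →
    ∀ x : WObj G.toSGrpData (n+1),
    Wd G.toSGrpData (n+1) (i+1) (Ws G.toSGrpData (n+1) j x) =
      Ws G.toSGrpData n j (Wd G.toSGrpData n i x)
  | 0, i+1, 0, _, h', x => Prod.ext (G.d_s_gt 0 (i+2) 0 (by omega) (by omega) x.1) rfl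
  | n+1, i+1, 0, _, h', x =>
    Prod.ext (G.d_s_gt (n+1) (i+2) 0 (by omega) (by omega) x.1) rfl
  | 0, i+1, j+1, h, h', _ => by omega
  | n+1, i+1, j+1, h, h', x =>
    Prod.ext (G.d_s_gt (n+1) (i+2) (j+1) (by omega) (by omega) x.1)
      (Wd_Ws_of_lt G n i j (by omega) (by omega) x.2)

/-- For every simplicial group `G`, the data `W_gr G` (with componentwise group
structure and the faces/degeneracies `Wd`/`Ws` defined above) satisfies the simplicial
identities and all its face and degeneracy maps are group homomorphisms; hence `W_gr G` is a
simplicial group. -/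
theorem Wgr_isSimplicialGroup (G : SGrp.{u}) :
    IsSimplicialGroup (WgrData G.toSGrpData) ∧
    ∃ H : SGrp.{u}, H.toSGrpData = WgrData G.toSGrpData := by
  have key : IsSimplicialGroup (WgrData G.toSGrpData) := by
    refine ⟨Wd_mul G, Ws_mul G, ?_, Ws_Ws G, ?_, Wd_Ws_self G, Wd_succ_Ws G, ?_⟩
    · rintro n i (_ | j) h h' x
      · omega
      · exact Wd_Wd G n i j (by omega) (by omega) x
    · rintro n i (_ | j) h h' x
      · omega
      · exact Wd_Ws_of_le G n i j (by omega) (by omega) x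
    · rintro n (_ | i) j h h' x
      · omega
      · exact Wd_Ws_of_lt G n i j (by omega) (by omega) x
  refine ⟨key, ?_⟩
  obtain ⟨d_mul, s_mul, d_d, s_s, d_s_lt, d_s_self, d_s_succ, d_s_gt⟩ := key
  exact ⟨⟨WgrData G.toSGrpData, d_mul, s_mul, d_d, s_s, d_s_lt, d_s_self, d_s_succ, d_s_gt⟩, rfl⟩
end

section
/- For every simplicial group G, the maps Φ_n : (WG)_n → (W_gr G)_n sending (g_n, ..., g_0) to (k_n, k_{n-1}, ..., k_0), where k_n = g_n and k_{j-1} = d_0(k_j) · g_{j-1} for j ≤ n, commute with all face and degeneracy maps, and thus define a morphism of simplicial sets Φ : WG → W_gr G. -/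
universe u

/-- Levelwise (componentwise) application of a family of maps to the W-construction;
this is both `W f` and `W_gr f` on morphisms. -/
def Wmap (G H : SGrpData.{u}) (f : ∀ n, G.X n → H.X n) : ∀ n, WObj G n → WObj H n
  | 0, x => f 0 x
  | n+1, x => (f (n+1) x.1, Wmap G H f n x.2)

/-- First-factor projection `(W_gr G)_n = G_n × ⋯ × G_0 → G_n`. -/
def Wfst (G : SGrpData.{u}) : ∀ n, WObj G n → G.X n
  | 0, x => x
  | _+1, x => x.1

/-- The unit `ι_G : G → W_gr G`, `g ↦ (g, d_0 g, d_0² g, …, d_0ⁿ g)`. -/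
def Wiota (G : SGrpData.{u}) : ∀ n, G.X n → WObj G n
  | 0, g => g
  | n+1, g => (g, Wiota G n (G.d n 0 g))

/-- The multiplication `μ_G : W_gr (W_gr G) → W_gr G`, levelwise the product of
the first-factor projections. -/
def Wmu (G : SGrpData.{u}) : ∀ n, WObj (WgrData G) n → WObj G n :=
  Wmap (WgrData G) G (fun n => Wfst G n)

/-- Multiplication on the first factor: `a • (g_n, …, g_0) = (a·g_n, g_{n-1}, …, g_0)`.
This is the `G`-action on the classical `WG`. -/
def mulFst (G : SGrpData.{u}) : ∀ n, G.X n → WObj G n → WObj G n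
  | 0, a, x => @HMul.hMul (G.X 0) (G.X 0) (G.X 0) _ a x
  | _+1, a, x => (a * x.1, x.2)

/-- Face maps of the classical universal bundle `WG`:
`d_0(g_n,…,g_0) = (d_0(g_n)·g_{n-1}, g_{n-2},…,g_0)` and for `i > 0`
`d_i(g_n,…,g_0) = (d_i g_n, …, d_1 g_{n-i+1}, d_0(g_{n-i})·g_{n-i-1}, g_{n-i-2},…,g_0)`. -/
def WBd (G : SGrpData.{u}) : ∀ n, ℕ → WObj G (n+1) → WObj G n
  | n, 0, x => mulFst G n (G.d n 0 x.1) x.2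
  | 0, i+1, x => G.d 0 (i+1) x.1
  | n+1, i+1, x => (G.d (n+1) (i+1) x.1, WBd G n i x.2)

/-- Degeneracy maps of the classical `WG`:
`s_i(g_n,…,g_0) = (s_i g_n, …, s_0 g_{n-i}, 1, g_{n-i-1},…,g_0)`. -/
def WBs (G : SGrpData.{u}) : ∀ n, ℕ → WObj G n → WObj G (n+1)
  | 0, _, x => (G.s 0 0 x, 1)
  | n+1, 0, x => (G.s (n+1) 0 x.1, ((1 : G.X (n+1)), x.2))
  | n+1, i+1, x => (G.s (n+1) (i+1) x.1, WBs G n i x.2)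

/-- The standard inclusion `G → WG`, `g ↦ (g, 1, …, 1)`. -/
def WBiota (G : SGrpData.{u}) : ∀ n, G.X n → WObj G n
  | 0, g => g
  | n+1, g => (g, (1 : WObj G n))

/-- `Φ : WG → W_gr G`, `(g_n, …, g_0) ↦ (k_n, …, k_0)` with `k_n = g_n` and
`k_{j-1} = d_0(k_j)·g_{j-1}`. -/
def Phi (G : SGrpData.{u}) : ∀ n, WObj G n → WObj G n
  | 0, x => x
  | n+1, x => (x.1, Phi G n (mulFst G n (G.d n 0 x.1) x.2))

/-- `Φ⁻¹ : W_gr G → WG`, `(h_n, …, h_0) ↦ (h_n, d_0(h_n)⁻¹·h_{n-1}, …, d_0(h_1)⁻¹·h_0)`. -/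
def PhiInv (G : SGrpData.{u}) : ∀ n, WObj G n → WObj G n
  | 0, x => x
  | n+1, x => (x.1, mulFst G n (G.d n 0 x.1)⁻¹ (PhiInv G n x.2))

/-- `f` is a morphism of simplicial groups `G → H`: levelwise a group homomorphism,
commuting with all face and degeneracy maps. -/
def IsSMor (G H : SGrpData.{u}) (f : ∀ n, G.X n → H.X n) : Prop :=
  (∀ n (x y : G.X n), f n (x * y) = f n x * f n y) ∧
  (∀ n i, i ≤ n + 1 → ∀ x : G.X (n+1), f n (G.d n i x) = H.d n i (f (n+1) x)) ∧
  (∀ n i, i ≤ n → ∀ x : G.X n, f (n+1) (G.s n i x) = H.s n i (f n x))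

theorem mulFst_mul (G : SGrpData.{u}) (n : ℕ) (a b : G.X n) (x : WObj G n) :
    mulFst G n (a * b) x = mulFst G n a (mulFst G n b x) := by
  cases n with
  | zero => exact mul_assoc (G := G.X 0) a b x
  | succ n => exact Prod.ext (mul_assoc a b x.1) rfl

/-- The face maps of `WG` are equivariant for the action of `G`. -/
theorem WBd_mulFst (G : SGrp.{u}) (n i : ℕ) (a : G.X (n+1)) (x : WObj G.toSGrpData (n+1)) :
    WBd G.toSGrpData n i (mulFst G.toSGrpData (n+1) a x) =
      mulFst G.toSGrpData n (G.d n i a) (WBd G.toSGrpData n i x) := by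
  match n, i with
  | n, 0 =>
    simp only [WBd]
    rw [← mulFst_mul, ← G.d_mul]
    rfl
  | 0, i+1 => exact G.d_mul 0 (i+1) a x.1
  | n+1, i+1 => exact Prod.ext (G.d_mul (n+1) (i+1) a x.1) rfl

/-- The degeneracy maps of `WG` are equivariant for the action of `G`. -/
theorem WBs_mulFst (G : SGrp.{u}) (n i : ℕ) (hi : i ≤ n) (a : G.X n)
    (x : WObj G.toSGrpData n) :
    WBs G.toSGrpData n i (mulFst G.toSGrpData n a x) =
      mulFst G.toSGrpData (n+1) (G.s n i a) (WBs G.toSGrpData n i x) := by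
  match n, i with
  | 0, 0 => exact Prod.ext (G.s_mul 0 0 a x) rfl
  | n+1, 0 => exact Prod.ext (G.s_mul (n+1) 0 a x.1) rfl
  | n+1, i+1 => exact Prod.ext (G.s_mul (n+1) (i+1) a x.1) rfl

theorem Phi_WBd (G : SGrp.{u}) : ∀ n i, i ≤ n + 1 → ∀ x : WObj G.toSGrpData (n+1),
    Phi G.toSGrpData n (WBd G.toSGrpData n i x) =
      Wd G.toSGrpData n i (Phi G.toSGrpData (n+1) x)
  | n, 0, _, x => by cases n <;> rfl
  | 0, i+1, _, x => rfl
  | n+1, i+1, hi, x => by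
    refine Prod.ext rfl ?_
    simp only [WBd, Wd, Phi]
    rw [G.d_d n 0 (i+1) (by omega) (by omega), Nat.add_sub_cancel, ← WBd_mulFst,
      Phi_WBd G n i (by omega)]
    rfl

theorem Phi_WBs (G : SGrp.{u}) : ∀ n i, i ≤ n → ∀ x : WObj G.toSGrpData n,
    Phi G.toSGrpData (n+1) (WBs G.toSGrpData n i x) =
      Ws G.toSGrpData n i (Phi G.toSGrpData n x)
  | 0, 0, _, x => by
    refine Prod.ext rfl ?_
    exact (mul_one (G.d 0 0 (G.s 0 0 x))).trans (G.d_s_self 0 0 le_rfl x)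
  | n+1, 0, _, x => by
    refine Prod.ext rfl ?_
    refine congrArg (Phi G.toSGrpData (n+1)) (Prod.ext ?_ rfl)
    exact (mul_one (G.d (n+1) 0 (G.s (n+1) 0 x.1))).trans
      (G.d_s_self (n+1) 0 (Nat.zero_le _) x.1)
  | n+1, i+1, hi, x => by
    refine Prod.ext rfl ?_
    change Phi G.toSGrpData (n+1) (mulFst G.toSGrpData (n+1)
      (G.d (n+1) 0 (G.s (n+1) (i+1) x.1)) (WBs G.toSGrpData n i x.2)) = _
    rw [G.d_s_lt n 0 (i+1) (by omega) (by omega), Nat.add_sub_cancel,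
      ← WBs_mulFst G n i (by omega), Phi_WBs G n i (by omega)]
    rfl

/-- For every simplicial group `G`, the maps `Φ_n : (WG)_n → (W_gr G)_n`,
`(g_n,…,g_0) ↦ (k_n,…,k_0)` with `k_n = g_n`, `k_{j-1} = d_0(k_j)·g_{j-1}`, commute with all
face and degeneracy maps, and thus define a morphism of simplicial sets `Φ : WG → W_gr G`. -/
theorem Phi_is_simplicial_map (G : SGrp.{u}) :
    (∀ n i, i ≤ n + 1 → ∀ x : WObj G.toSGrpData (n+1),
      Phi G.toSGrpData n (WBd G.toSGrpData n i x) =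
        Wd G.toSGrpData n i (Phi G.toSGrpData (n+1) x)) ∧
    (∀ n i, i ≤ n → ∀ x : WObj G.toSGrpData n,
      Phi G.toSGrpData (n+1) (WBs G.toSGrpData n i x) =
        Ws G.toSGrpData n i (Phi G.toSGrpData n x)) :=
  ⟨Phi_WBd G, Phi_WBs G⟩
end

section
/- The isomorphisms Φ : WG → W_gr G are natural in G: for every morphism of simplicial groups f : G → H, one has (W_gr f) ∘ Φ_G = Φ_H ∘ (W f), where W f and W_gr f are applied componentwise. Hence the endofunctor W_gr on simplicial groups is a lift, up to natural isomorphism, of the universal bundle functor W through the forgetful functor from simplicial groups to simplicial sets. -/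
universe u

theorem Wmap_mulFst (G H : SGrpData.{u}) (f : ∀ n, G.X n → H.X n)
    (hf : ∀ n (x y : G.X n), f n (x * y) = f n x * f n y) (n : ℕ) (a : G.X n) (x : WObj G n) :
    Wmap G H f n (mulFst G n a x) = mulFst H n (f n a) (Wmap G H f n x) := by
  cases n with
  | zero => exact hf 0 a x
  | succ n => exact Prod.ext (hf (n + 1) a x.1) rfl

theorem mulFst_inv_mulFst (G : SGrpData.{u}) (n : ℕ) (a : G.X n) (x : WObj G n) :
    mulFst G n a⁻¹ (mulFst G n a x) = x := by
  cases n with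
  | zero => exact inv_mul_cancel_left (G := G.X 0) a x
  | succ n => exact Prod.ext (inv_mul_cancel_left a x.1) rfl

theorem mulFst_mulFst_inv (G : SGrpData.{u}) (n : ℕ) (a : G.X n) (x : WObj G n) :
    mulFst G n a (mulFst G n a⁻¹ x) = x := by
  simpa only [inv_inv] using mulFst_inv_mulFst G n a⁻¹ x

theorem Phi_leftInverse (G : SGrpData.{u}) (n : ℕ) :
    Function.LeftInverse (PhiInv G n) (Phi G n) := by
  induction n with
  | zero => exact fun _ => rfl
  | succ n ih =>
    intro x
    refine Prod.ext rfl ?_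
    change mulFst G n (G.d n 0 x.1)⁻¹ (PhiInv G n (Phi G n (mulFst G n (G.d n 0 x.1) x.2))) = x.2
    rw [ih, mulFst_inv_mulFst]

theorem Phi_rightInverse (G : SGrpData.{u}) (n : ℕ) :
    Function.RightInverse (PhiInv G n) (Phi G n) := by
  induction n with
  | zero => exact fun _ => rfl
  | succ n ih =>
    intro x
    refine Prod.ext rfl ?_
    change Phi G n (mulFst G n (G.d n 0 x.1) (mulFst G n (G.d n 0 x.1)⁻¹ (PhiInv G n x.2))) = x.2
    rw [mulFst_mulFst_inv, ih]

theorem Wmap_Phi (G H : SGrpData.{u}) (f : ∀ n, G.X n → H.X n) (hf : IsSMor G H f)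
    (n : ℕ) (x : WObj G n) : Wmap G H f n (Phi G n x) = Phi H n (Wmap G H f n x) := by
  induction n with
  | zero => rfl
  | succ n ih =>
    refine Prod.ext rfl ?_
    change Wmap G H f n (Phi G n (mulFst G n (G.d n 0 x.1) x.2)) =
      Phi H n (mulFst H n (H.d n 0 (f (n + 1) x.1)) (Wmap G H f n x.2))
    rw [ih, Wmap_mulFst G H f hf.1, hf.2.1 n 0 (Nat.zero_le _)]

/-- The isomorphisms `Φ : WG → W_gr G` are natural in `G`: for every morphism
of simplicial groups `f : G → H`, `(W_gr f) ∘ Φ_G = Φ_H ∘ (W f)` (both `W f` and `W_gr f`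
being applied componentwise).  Hence the endofunctor `W_gr` is a lift, up to natural
isomorphism, of the universal bundle functor `W` through the forgetful functor from
simplicial groups to simplicial sets. -/
theorem Phi_natural :
    (∀ (G H : SGrp.{u}) (f : ∀ n, G.X n → H.X n),
      IsSMor G.toSGrpData H.toSGrpData f →
        ∀ n (x : WObj G.toSGrpData n),
          Wmap G.toSGrpData H.toSGrpData f n (Phi G.toSGrpData n x) =
            Phi H.toSGrpData n (Wmap G.toSGrpData H.toSGrpData f n x)) ∧
    (∀ (G : SGrp.{u}) (n : ℕ), Function.Bijective (Phi G.toSGrpData n)) := by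
  exact ⟨fun G H f hf n x => Wmap_Phi G.toSGrpData H.toSGrpData f hf n x,
    fun G n => ⟨(Phi_leftInverse G.toSGrpData n).injective,
      (Phi_rightInverse G.toSGrpData n).surjective⟩⟩
end

section
/- For every simplicial group G, the maps (μ_G)_n : (W_gr(W_gr G))_n → (W_gr G)_n, defined as the product pr_1 × pr_1 × ... × pr_1 of the first-factor projections pr_1 : (W_gr G)_j → G_j applied to each of the components (W_gr G)_n, (W_gr G)_{n-1}, ..., (W_gr G)_0, are group homomorphisms commuting with all face and degeneracy maps, and hence assemble into a morphism of simplicial groups μ_G : W_gr(W_gr G) → W_gr G. -/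
universe u

/-- The first-factor projection is multiplicative. -/
theorem Wfst_mul (G : SGrpData.{u}) :
    ∀ n (x y : WObj G n), Wfst G n (x * y) = Wfst G n x * Wfst G n y
  | 0, _, _ => rfl
  | _+1, _, _ => rfl

/-- The first-factor projection commutes with the faces of positive index. -/
theorem Wfst_Wd_succ (G : SGrpData.{u}) :
    ∀ n i (x : WObj G (n+1)), Wfst G n (Wd G n (i+1) x) = G.d n (i+1) (Wfst G (n+1) x)
  | 0, _, _ => rfl
  | _+1, _, _ => rfl

/-- The first-factor projection commutes with the degeneracies. -/
theorem Wfst_Ws (G : SGrpData.{u}) :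
    ∀ n i, i ≤ n → ∀ x : WObj G n, Wfst G (n+1) (Ws G n i x) = G.s n i (Wfst G n x)
  | 0, 0, _, _ => rfl
  | _+1, 0, _, _ => rfl
  | _+1, _+1, _, _ => rfl

/-- A levelwise multiplicative family induces a levelwise multiplicative `Wmap`. -/
theorem Wmap_mul (G H : SGrpData.{u}) (f : ∀ n, G.X n → H.X n)
    (hf : ∀ n (x y : G.X n), f n (x * y) = f n x * f n y) :
    ∀ n (x y : WObj G n), Wmap G H f n (x * y) = Wmap G H f n x * Wmap G H f n y
  | 0, x, y => hf 0 x y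
  | n+1, x, y => Prod.ext (hf (n+1) x.1 y.1) (Wmap_mul G H f hf n x.2 y.2)

/-- `Wmap` commutes with all faces as soon as the family commutes with those of positive index. -/
theorem Wmap_Wd (G H : SGrpData.{u}) (f : ∀ n, G.X n → H.X n)
    (hf : ∀ n i (x : G.X (n+1)), f n (G.d n (i+1) x) = H.d n (i+1) (f (n+1) x)) :
    ∀ n i (x : WObj G (n+1)), Wmap G H f n (Wd G n i x) = Wd H n i (Wmap G H f (n+1) x)
  | 0, 0, _ => rfl
  | _+1, 0, _ => rfl
  | 0, i+1, x => hf 0 i x.1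
  | n+1, i+1, x => Prod.ext (hf (n+1) i x.1) (Wmap_Wd G H f hf n i x.2)

/-- `Wmap` commutes with the degeneracies if the family does. -/
theorem Wmap_Ws (G H : SGrpData.{u}) (f : ∀ n, G.X n → H.X n)
    (hf : ∀ n i, i ≤ n → ∀ x : G.X n, f (n+1) (G.s n i x) = H.s n i (f n x)) :
    ∀ n i, i ≤ n → ∀ x : WObj G n,
      Wmap G H f (n+1) (Ws G n i x) = Ws H n i (Wmap G H f n x)
  | 0, 0, h, x => Prod.ext (hf 0 0 h x) rfl
  | n+1, 0, h, x => Prod.ext (hf (n+1) 0 h x.1) rfl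
  | n+1, i+1, h, x =>
    Prod.ext (hf (n+1) (i+1) h x.1) (Wmap_Ws G H f hf n i (Nat.le_of_succ_le_succ h) x.2)

/-- For every simplicial group `G`, the maps
`(μ_G)_n : (W_gr(W_gr G))_n → (W_gr G)_n`, the products `pr₁ × ⋯ × pr₁` of the first-factor
projections `(W_gr G)_j → G_j`, are group homomorphisms commuting with all face and
degeneracy maps, hence assemble into a morphism of simplicial groups
`μ_G : W_gr(W_gr G) → W_gr G`. -/
theorem mu_is_morphism (G : SGrp.{u}) :
    (∀ n (x y : WObj (WgrData G.toSGrpData) n),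
      Wmu G.toSGrpData n (x * y) = Wmu G.toSGrpData n x * Wmu G.toSGrpData n y) ∧
    (∀ n i, i ≤ n + 1 → ∀ x : WObj (WgrData G.toSGrpData) (n+1),
      Wmu G.toSGrpData n (Wd (WgrData G.toSGrpData) n i x) =
        Wd G.toSGrpData n i (Wmu G.toSGrpData (n+1) x)) ∧
    (∀ n i, i ≤ n → ∀ x : WObj (WgrData G.toSGrpData) n,
      Wmu G.toSGrpData (n+1) (Ws (WgrData G.toSGrpData) n i x) =
        Ws G.toSGrpData n i (Wmu G.toSGrpData n x)) ∧
    IsSMor (WgrData (WgrData G.toSGrpData)) (WgrData G.toSGrpData) (Wmu G.toSGrpData) := by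
  have hmul := Wmap_mul (WgrData G.toSGrpData) G.toSGrpData _ (Wfst_mul G.toSGrpData)
  have hd := Wmap_Wd (WgrData G.toSGrpData) G.toSGrpData _ (Wfst_Wd_succ G.toSGrpData)
  have hs := Wmap_Ws (WgrData G.toSGrpData) G.toSGrpData _ (Wfst_Ws G.toSGrpData)
  exact ⟨hmul, fun n i _ => hd n i, hs, hmul, fun n i _ => hd n i, hs⟩
end

section
/- For every simplicial group G, the associativity law μ_G ∘ W_gr(μ_G) = μ_G ∘ μ_{W_gr G} holds as an equality of morphisms of simplicial groups W_gr(W_gr(W_gr G)) → W_gr G. -/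
universe u

/-- `Wmap` respects composition. -/
theorem Wmap_Wmap (G H K : SGrpData.{u}) (f : ∀ n, G.X n → H.X n) (g : ∀ n, H.X n → K.X n) :
    ∀ n (x : WObj G n), Wmap H K g n (Wmap G H f n x) = Wmap G K (fun m y => g m (f m y)) n x
  | 0, _ => rfl
  | n+1, x => congrArg (Prod.mk (g (n+1) (f (n+1) x.1))) (Wmap_Wmap G H K f g n x.2)

/-- The first-factor projection is natural with respect to `Wmap`. -/
theorem Wfst_Wmap (G H : SGrpData.{u}) (f : ∀ n, G.X n → H.X n) :
    ∀ n (x : WObj G n), Wfst H n (Wmap G H f n x) = f n (Wfst G n x)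
  | 0, _ => rfl
  | _+1, _ => rfl

/-- For every simplicial group `G`, the associativity law
`μ_G ∘ W_gr(μ_G) = μ_G ∘ μ_{W_gr G}` holds as an equality of morphisms of simplicial groups
`W_gr(W_gr(W_gr G)) → W_gr G`. -/
theorem mu_assoc (G : SGrp.{u}) :
    ∀ n (x : WObj (WgrData (WgrData G.toSGrpData)) n),
      Wmu G.toSGrpData n
        (Wmap (WgrData (WgrData G.toSGrpData)) (WgrData G.toSGrpData)
          (Wmu G.toSGrpData) n x) =
      Wmu G.toSGrpData n (Wmu (WgrData G.toSGrpData) n x) := by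
  intro n x
  have h : (fun m (y : WObj (WgrData G.toSGrpData) m) =>
      Wfst G.toSGrpData m (Wmu G.toSGrpData m y)) =
      fun m y => Wfst G.toSGrpData m (Wfst (WgrData G.toSGrpData) m y) :=
    funext fun m => funext fun y => Wfst_Wmap _ _ _ m y
  exact (Wmap_Wmap _ _ _ _ _ n x).trans <|
    (congrArg (fun f => Wmap (WgrData (WgrData G.toSGrpData)) G.toSGrpData f n x) h).trans
      (Wmap_Wmap _ _ _ _ _ n x).symm
end

section
/- For every simplicial group G, the unit laws μ_G ∘ W_gr(ι_G) = id_{W_gr G} and μ_G ∘ ι_{W_gr G} = id_{W_gr G} hold as equalities of morphisms of simplicial groups W_gr G → W_gr G. Together with naturality and associativity of μ, this shows that (W_gr, ι, μ) is a monad on the category of simplicial groups. -/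
universe u

theorem Wd_zero (G : SGrpData.{u}) : ∀ n (x : WObj G (n+1)), Wd G n 0 x = x.2
  | 0, _ => rfl
  | _+1, _ => rfl

theorem Wfst_Wiota (G : SGrpData.{u}) : ∀ n (g : G.X n), Wfst G n (Wiota G n g) = g
  | 0, _ => rfl
  | _+1, _ => rfl

theorem Wmap_congr (G H : SGrpData.{u}) {f g : ∀ n, G.X n → H.X n}
    (h : ∀ n x, f n x = g n x) (n : ℕ) (x : WObj G n) : Wmap G H f n x = Wmap G H g n x := by
  rw [show f = g from funext fun n => funext (h n)]

theorem Wmap_id (G : SGrpData.{u}) : ∀ n (x : WObj G n), Wmap G G (fun _ g => g) n x = x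
  | 0, _ => rfl
  | n+1, x => Prod.ext rfl (Wmap_id G n x.2)

theorem Wmap_comp (G H K : SGrpData.{u}) (g : ∀ n, H.X n → K.X n) (f : ∀ n, G.X n → H.X n) :
    ∀ n (x : WObj G n),
      Wmap H K g n (Wmap G H f n x) = Wmap G K (fun n y => g n (f n y)) n x
  | 0, _ => rfl
  | n+1, x => Prod.ext rfl (Wmap_comp G H K g f n x.2)

theorem Wmu_Wmap_Wiota (G : SGrpData.{u}) (n : ℕ) (x : WObj G n) :
    Wmu G n (Wmap G (WgrData G) (Wiota G) n x) = x :=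
  (Wmap_comp G (WgrData G) G _ _ n x).trans
    ((Wmap_congr G G (Wfst_Wiota G) n x).trans (Wmap_id G n x))

theorem Wmu_Wiota (G : SGrpData.{u}) :
    ∀ n (x : WObj G n), Wmu G n (Wiota (WgrData G) n x) = x
  | 0, _ => rfl
  | n+1, x => Prod.ext rfl
      ((congrArg (fun y => Wmu G n (Wiota (WgrData G) n y)) (Wd_zero G n x)).trans
        (Wmu_Wiota G n x.2))

/-- Naturality of `μ`, valid for any levelwise family of maps. -/
theorem Wmap_Wmu (G H : SGrpData.{u}) (f : ∀ n, G.X n → H.X n) (n : ℕ)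
    (x : WObj (WgrData G) n) :
    Wmap G H f n (Wmu G n x) =
      Wmu H n (Wmap (WgrData G) (WgrData H) (Wmap G H f) n x) :=
  (Wmap_comp (WgrData G) G H _ _ n x).trans
    ((Wmap_congr (WgrData G) H (fun n y => (Wfst_Wmap G H f n y).symm) n x).trans
      (Wmap_comp (WgrData G) (WgrData H) H _ _ n x).symm)

theorem Wmap_Wiota (G H : SGrpData.{u}) (f : ∀ n, G.X n → H.X n)
    (hf : ∀ n (x : G.X (n+1)), f n (G.d n 0 x) = H.d n 0 (f (n+1) x)) :
    ∀ n (g : G.X n), Wmap G H f n (Wiota G n g) = Wiota H n (f n g)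
  | 0, _ => rfl
  | n+1, g => Prod.ext rfl
      ((Wmap_Wiota G H f hf n (G.d n 0 g)).trans (congrArg (Wiota H n) (hf n g)))

/-- For every simplicial group `G`, the unit laws
`μ_G ∘ W_gr(ι_G) = id` and `μ_G ∘ ι_{W_gr G} = id` hold as equalities of morphisms of
simplicial groups `W_gr G → W_gr G`.  Together with naturality of `ι` and `μ` and
associativity of `μ`, this shows that `(W_gr, ι, μ)` is a monad on the category of
simplicial groups. -/
theorem Wgr_monad (G : SGrp.{u}) :
    -- unit laws
    (∀ n (x : WObj G.toSGrpData n),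
      Wmu G.toSGrpData n
        (Wmap G.toSGrpData (WgrData G.toSGrpData) (Wiota G.toSGrpData) n x) = x) ∧
    (∀ n (x : WObj G.toSGrpData n),
      Wmu G.toSGrpData n (Wiota (WgrData G.toSGrpData) n x) = x) ∧
    -- associativity
    (∀ n (x : WObj (WgrData (WgrData G.toSGrpData)) n),
      Wmu G.toSGrpData n
        (Wmap (WgrData (WgrData G.toSGrpData)) (WgrData G.toSGrpData)
          (Wmu G.toSGrpData) n x) =
      Wmu G.toSGrpData n (Wmu (WgrData G.toSGrpData) n x)) ∧
    -- naturality of `ι` and `μ`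
    (∀ (H : SGrp.{u}) (f : ∀ n, G.X n → H.X n), IsSMor G.toSGrpData H.toSGrpData f →
      (∀ n (g : G.X n),
        Wmap G.toSGrpData H.toSGrpData f n (Wiota G.toSGrpData n g) =
          Wiota H.toSGrpData n (f n g)) ∧
      (∀ n (x : WObj (WgrData G.toSGrpData) n),
        Wmap G.toSGrpData H.toSGrpData f n (Wmu G.toSGrpData n x) =
          Wmu H.toSGrpData n
            (Wmap (WgrData G.toSGrpData) (WgrData H.toSGrpData)
              (Wmap G.toSGrpData H.toSGrpData f) n x))) := by
  exact ⟨Wmu_Wmap_Wiota _, Wmu_Wiota _,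
    fun n x => (Wmap_Wmu (WgrData G.toSGrpData) G.toSGrpData (Wfst G.toSGrpData) n x).symm,
    fun H f hf => ⟨Wmap_Wiota _ _ f fun n => hf.2.1 n 0 (Nat.zero_le _), Wmap_Wmu _ _ f⟩⟩
end
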